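/- Let p1, p2 be probability mass functions on {0,1}×𝒴1 and {0,1}×𝒴2 respectively, let q be their combined distribution, and let α∈(0,1)∪(1,2]∪[3,∞). Set δ = 2^{1−α} and K_i = exp((1−α)·H^H_α(X_i|Y_i)_{p_i}) for i=1,2. Then H^H_α(X_1⊕X_2|Y_1Y_2)_q ≤ (1/(1−α))·log[ (δ−K_1)(δ−K_2)/(1−δ) + δ ]. For α∈[2,3] the same holds with ≤ replaced by ≥, and for α∈{2,3} it holds with equality. -/

import Mathlib

open Finset

/-- `p` is a probability mass function on a finite type. -/
def IsPMF {Ω : Type*} [Fintype Ω] (p : Ω → ℝ) : Prop :=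
  (∀ ω, 0 ≤ p ω) ∧ ∑ ω, p ω = 1

/-- Marginal distribution of the second component. -/
noncomputable def margY {X Y : Type*} [Fintype X] (p : X × Y → ℝ) (y : Y) : ℝ := ∑ x, p (x, y)

/-- Conditional distribution `p(x|y)`. -/
noncomputable def condXY {X Y : Type*} [Fintype X] (p : X × Y → ℝ) (x : X) (y : Y) : ℝ :=
  p (x, y) / margY p y

/-- Hayashi conditional Rényi entropy `H^H_α(X|Y)_p`. -/
noncomputable def HH {X Y : Type*} [Fintype X] [Fintype Y] (α : ℝ) (p : X × Y → ℝ) : ℝ :=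
  (1 / (1 - α)) * Real.log (∑ y, margY p y * ∑ x, condXY p x y ^ α)

/-- Arimoto conditional Rényi entropy `H^A_α(X|Y)_p`. -/
noncomputable def HA {X Y : Type*} [Fintype X] [Fintype Y] (α : ℝ) (p : X × Y → ℝ) : ℝ :=
  (α / (1 - α)) * Real.log (∑ y, margY p y * (∑ x, condXY p x y ^ α) ^ (1 / α))

/-- The tilted probability mass function `p̄`. -/
noncomputable def tilt {X Y : Type*} [Fintype X] [Fintype Y] (α : ℝ) (p : X × Y → ℝ) :
    X × Y → ℝ := fun (x, y) =>
  condXY p x y ^ α * margY p y / ∑ xy : X × Y, condXY p xy.1 xy.2 ^ α * margY p xy.2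

variable {Y1 Y2 : Type*} [Fintype Y1] [Fintype Y2]

/-- The joint distribution of `Z = X₁ ⊕ X₂` and the side information `(Y₁, Y₂)` under the
combined distribution `q(z,x₂,y₁,y₂) = p₁(z ⊕ x₂, y₁) p₂(x₂, y₂)`. -/
noncomputable def combinedZ (p1 : ZMod 2 × Y1 → ℝ) (p2 : ZMod 2 × Y2 → ℝ) :
    ZMod 2 × (Y1 × Y2) → ℝ := fun zy => ∑ x2 : ZMod 2, p1 (zy.1 + x2, zy.2.1) * p2 (x2, zy.2.2)

/-- The joint distribution of `X₂` and `(Z = X₁ ⊕ X₂, Y₁, Y₂)` under the combined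
distribution `q(z,x₂,y₁,y₂) = p₁(z ⊕ x₂, y₁) p₂(x₂, y₂)`. -/
noncomputable def combinedX2 (p1 : ZMod 2 × Y1 → ℝ) (p2 : ZMod 2 × Y2 → ℝ) :
    ZMod 2 × (ZMod 2 × Y1 × Y2) → ℝ := fun xw =>
  p1 (xw.2.1 + xw.1, xw.2.2.1) * p2 (xw.1, xw.2.2.2)


/-- For `β ≤ 0` the power function is convex on the positive reals. -/
lemma convexOn_rpow_of_nonpos {β : ℝ} (hβ : β ≤ 0) :
    ConvexOn ℝ (Set.Ioi 0) fun x : ℝ ↦ x ^ β := by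
  refine ⟨convex_Ioi 0, fun x hx y hy a b ha hb hab ↦ ?_⟩
  have hx' : (0 : ℝ) < x := hx
  have hy' : (0 : ℝ) < y := hy
  have hz : (0 : ℝ) < a • x + b • y := (convex_Ioi (0 : ℝ)) hx hy ha hb hab
  have hlog := strictConcaveOn_log_Ioi.concaveOn.2 hx hy ha hb hab
  have hexp := convexOn_exp.2 (Set.mem_univ (Real.log x * β)) (Set.mem_univ (Real.log y * β))
    ha hb hab
  simp only [Real.rpow_def_of_pos hx', Real.rpow_def_of_pos hy', Real.rpow_def_of_pos hz]
  refine le_trans (Real.exp_le_exp.2 ?_) hexp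
  simp only [smul_eq_mul] at hlog ⊢
  nlinarith [mul_le_mul_of_nonpos_right hlog hβ]

/-- A convex function takes larger symmetric sums at more spread-out points. -/
lemma ConvexOn.add_le_add_of_abs_le {φ : ℝ → ℝ} {S : Set ℝ} (hφ : ConvexOn ℝ S φ) {A s t : ℝ}
    (hp : A + s ∈ S) (hm : A - s ∈ S) (hts : |t| ≤ s) :
    φ (A + t) + φ (A - t) ≤ φ (A + s) + φ (A - s) := by
  obtain ⟨h1, h2⟩ := abs_le.1 hts
  rcases (abs_nonneg t |>.trans hts).eq_or_lt with rfl | hs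
  · obtain rfl : t = 0 := by linarith
    rfl
  have ha : 0 ≤ (s + t) / (2 * s) := div_nonneg (by linarith) (by linarith)
  have hb : 0 ≤ (s - t) / (2 * s) := div_nonneg (by linarith) (by linarith)
  have hab : (s + t) / (2 * s) + (s - t) / (2 * s) = 1 := by field_simp; ring
  have e1 := hφ.2 hp hm ha hb hab
  have e2 := hφ.2 hp hm hb ha (by rw [add_comm]; exact hab)
  have c1 : ((s + t) / (2 * s)) • (A + s) + ((s - t) / (2 * s)) • (A - s) = A + t := by
    simp only [smul_eq_mul]; field_simp; ring
  have c2 : ((s - t) / (2 * s)) • (A + s) + ((s + t) / (2 * s)) • (A - s) = A - t := by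
    simp only [smul_eq_mul]; field_simp; ring
  rw [c1] at e1
  rw [c2] at e2
  simp only [smul_eq_mul] at e1 e2
  linear_combination e1 + e2 + (φ (A + s) + φ (A - s)) * hab

/-- If `x ↦ σ x ^ β` is convex, then `σ` times the quotient of
`(1 + b t) ^ β + (1 - b t) ^ β` by `(1 + t) ^ β + (1 - t) ^ β` is nonincreasing in `t`
(in cross-multiplied form). -/
lemma rpow_symm_sum_mul_le {σ β b x y : ℝ}
    (hφ : ConvexOn ℝ (Set.Ioi 0) fun x : ℝ ↦ σ * x ^ β) (hb0 : 0 ≤ b) (hb1 : b ≤ 1)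
    (hx : 0 < x) (hxy : x < y) (hy : y < 1) :
    σ * (((1 + b * y) ^ β + (1 - b * y) ^ β) * ((1 + x) ^ β + (1 - x) ^ β)) ≤
      σ * (((1 + b * x) ^ β + (1 - b * x) ^ β) * ((1 + y) ^ β + (1 - y) ^ β)) := by
  have hbx : b * x ≤ x := by nlinarith
  have hby : b * y ≤ y := by nlinarith
  have hbx0 : 0 ≤ b * x := by positivity
  have hbxy : b * x ≤ b * y := by nlinarith
  have p1 : 0 < 1 + b * y := by linarith
  have p2 : 0 < 1 - b * y := by linarith
  have p3 : 0 < 1 + b * x := by linarith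
  have p4 : 0 < 1 - b * x := by linarith
  have p5 : 0 < 1 + x := by linarith
  have p6 : 0 < 1 - x := by linarith
  have p7 : 0 < 1 + y := by linarith
  have p8 : 0 < 1 - y := by linarith
  have hA := hφ.add_le_add_of_abs_le (A := 1 + b * x * y) (s := b * x + y) (t := b * y + x)
    (by rw [Set.mem_Ioi]; nlinarith [mul_pos p3 p7])
    (by rw [Set.mem_Ioi]; nlinarith [mul_pos p4 p8])
    (by rw [abs_le]; constructor <;> nlinarith)
  have hB := hφ.add_le_add_of_abs_le (A := 1 - b * x * y) (s := y - b * x) (t := b * y - x)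
    (by rw [Set.mem_Ioi]; nlinarith [mul_pos p4 p7])
    (by rw [Set.mem_Ioi]; nlinarith [mul_pos p3 p8])
    (by rw [abs_le]; constructor <;> nlinarith)
  rw [show 1 + b * x * y + (b * y + x) = (1 + b * y) * (1 + x) by ring,
    show 1 + b * x * y - (b * y + x) = (1 - b * y) * (1 - x) by ring,
    show 1 + b * x * y + (b * x + y) = (1 + b * x) * (1 + y) by ring,
    show 1 + b * x * y - (b * x + y) = (1 - b * x) * (1 - y) by ring,
    Real.mul_rpow p1.le p5.le, Real.mul_rpow p2.le p6.le, Real.mul_rpow p3.le p7.le,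
    Real.mul_rpow p4.le p8.le] at hA
  rw [show 1 - b * x * y + (b * y - x) = (1 + b * y) * (1 - x) by ring,
    show 1 - b * x * y - (b * y - x) = (1 - b * y) * (1 + x) by ring,
    show 1 - b * x * y + (y - b * x) = (1 - b * x) * (1 + y) by ring,
    show 1 - b * x * y - (y - b * x) = (1 + b * x) * (1 - y) by ring,
    Real.mul_rpow p1.le p6.le, Real.mul_rpow p2.le p5.le, Real.mul_rpow p4.le p7.le,
    Real.mul_rpow p3.le p8.le] at hB
  linarith

/-- Monotone quotient criterion: if `f 0 = g 0 = 0` and `f' / g'` is nonincreasing, then so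
is `f / g` (in cross-multiplied form). -/
lemma mul_le_mul_of_deriv_mul_le {f g f' g' : ℝ → ℝ} {x y : ℝ} (hx : 0 < x) (hxy : x < y)
    (hf : ContinuousOn f (Set.Icc 0 y)) (hg : ContinuousOn g (Set.Icc 0 y))
    (hff' : ∀ t ∈ Set.Ioo 0 y, HasDerivAt f (f' t) t)
    (hgg' : ∀ t ∈ Set.Ioo 0 y, HasDerivAt g (g' t) t) (hf0 : f 0 = 0) (hg0 : g 0 = 0)
    (hpos : ∀ t ∈ Set.Ioo 0 y, 0 < g' t)
    (h : ∀ c d, 0 < c → c < d → d < y → f' d * g' c ≤ f' c * g' d) :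
    f y * g x ≤ f x * g y := by
  have hgmono : StrictMonoOn g (Set.Icc 0 y) := by
    refine strictMonoOn_of_deriv_pos (convex_Icc 0 y) hg fun t ht ↦ ?_
    rw [interior_Icc] at ht
    rw [(hgg' t ht).deriv]
    exact hpos t ht
  have g1 : 0 < g x := hg0 ▸ hgmono ⟨le_rfl, by linarith⟩ ⟨hx.le, hxy.le⟩ hx
  have g2 : 0 < g y - g x := sub_pos.2 (hgmono ⟨hx.le, hxy.le⟩ ⟨by linarith, le_rfl⟩ hxy)
  obtain ⟨c, hc, ec⟩ := exists_ratio_hasDerivAt_eq_ratio_slope f f' hx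
    (hf.mono (Set.Icc_subset_Icc_right hxy.le)) (fun t ht ↦ hff' t ⟨ht.1, ht.2.trans hxy⟩) g g'
    (hg.mono (Set.Icc_subset_Icc_right hxy.le)) (fun t ht ↦ hgg' t ⟨ht.1, ht.2.trans hxy⟩)
  obtain ⟨d, hd, ed⟩ := exists_ratio_hasDerivAt_eq_ratio_slope f f' hxy
    (hf.mono (Set.Icc_subset_Icc_left hx.le)) (fun t ht ↦ hff' t ⟨hx.trans ht.1, ht.2⟩) g g'
    (hg.mono (Set.Icc_subset_Icc_left hx.le)) (fun t ht ↦ hgg' t ⟨hx.trans ht.1, ht.2⟩)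
  rw [hf0, hg0, sub_zero, sub_zero] at ec
  have gc := hpos c ⟨hc.1, hc.2.trans hxy⟩
  have gd := hpos d ⟨hx.trans hd.1, hd.2⟩
  have hcd := h c d hc.1 (hc.2.trans hd.1) hd.2
  have key : ((f y - f x) * g x) * (g' c * g' d) ≤ (f x * (g y - g x)) * (g' c * g' d) := by
    calc ((f y - f x) * g x) * (g' c * g' d) = (g x * (g y - g x)) * (f' d * g' c) := by
          linear_combination (-(g x * g' c)) * ed
      _ ≤ (g x * (g y - g x)) * (f' c * g' d) := by gcongr
      _ = (f x * (g y - g x)) * (g' c * g' d) := by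
          linear_combination ((g y - g x) * g' d) * ec
  have := le_of_mul_le_mul_right key (mul_pos gc gd)
  linarith

/-- The excess `((1 + t) ^ α + (1 - t) ^ α - 2) / (α (α - 1))`. -/
noncomputable def rpowExcess (α t : ℝ) : ℝ := ((1 + t) ^ α + (1 - t) ^ α - 2) / (α * (α - 1))

/-- The derivative of `rpowExcess`. -/
noncomputable def rpowExcessDeriv (α t : ℝ) : ℝ :=
  ((1 + t) ^ (α - 1) - (1 - t) ^ (α - 1)) / (α - 1)

lemma hasDerivAt_one_add_rpow {t : ℝ} (p : ℝ) (h : 0 < 1 + t) :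
    HasDerivAt (fun t : ℝ ↦ (1 + t) ^ p) (p * (1 + t) ^ (p - 1)) t := by
  simpa using ((hasDerivAt_id t).const_add 1).rpow_const (p := p) (Or.inl h.ne')

lemma hasDerivAt_one_sub_rpow {t : ℝ} (p : ℝ) (h : 0 < 1 - t) :
    HasDerivAt (fun t : ℝ ↦ (1 - t) ^ p) (-(p * (1 - t) ^ (p - 1))) t := by
  simpa using ((hasDerivAt_id t).const_sub 1).rpow_const (p := p) (Or.inl h.ne')

lemma hasDerivAt_rpowExcess {α t : ℝ} (hα : 0 < α) (h0 : 0 ≤ t) (h1 : t < 1) :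
    HasDerivAt (rpowExcess α) (rpowExcessDeriv α t) t := by
  have := (((hasDerivAt_one_add_rpow (t := t) α (by linarith)).add
    (hasDerivAt_one_sub_rpow (t := t) α (by linarith))).sub_const 2).div_const (α * (α - 1))
  refine this.congr_deriv ?_
  rw [rpowExcessDeriv, ← mul_neg, ← mul_add, mul_div_mul_left _ _ hα.ne', ← sub_eq_add_neg]

lemma hasDerivAt_rpowExcessDeriv {α t : ℝ} (hα1 : α ≠ 1) (h0 : 0 ≤ t) (h1 : t < 1) :
    HasDerivAt (rpowExcessDeriv α) ((1 + t) ^ (α - 2) + (1 - t) ^ (α - 2)) t := by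
  have := ((hasDerivAt_one_add_rpow (t := t) (α - 1) (by linarith)).sub
    (hasDerivAt_one_sub_rpow (t := t) (α - 1) (by linarith))).div_const (α - 1)
  refine this.congr_deriv ?_
  rw [sub_neg_eq_add, ← mul_add, mul_div_cancel_left₀ _ (sub_ne_zero.2 hα1),
    show α - 1 - 1 = α - 2 by ring]

lemma rpowExcess_zero (α : ℝ) : rpowExcess α 0 = 0 := by norm_num [rpowExcess]

lemma rpowExcessDeriv_zero (α : ℝ) : rpowExcessDeriv α 0 = 0 := by simp [rpowExcessDeriv]

lemma rpowExcessDeriv_pos {α t : ℝ} (hα1 : α ≠ 1) (h0 : 0 < t) (h1 : t < 1) :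
    0 < rpowExcessDeriv α t := by
  rcases hα1.lt_or_gt with h | h
  · refine div_pos_of_neg_of_neg (sub_neg.2 ?_) (by linarith)
    exact Real.rpow_lt_rpow_of_neg (by linarith) (by linarith) (by linarith)
  · refine div_pos (sub_pos.2 ?_) (by linarith)
    exact Real.rpow_lt_rpow (by linarith) (by linarith) (by linarith)

lemma rpowExcess_abs (α t : ℝ) : rpowExcess α |t| = rpowExcess α t := by
  rcases abs_choice t with h | h
  · rw [h]
  · rw [h, rpowExcess, rpowExcess, sub_neg_eq_add, ← sub_eq_add_neg, add_comm ((1 - t) ^ α)]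

lemma continuous_rpowExcess {α : ℝ} (hα : 0 < α) : Continuous (rpowExcess α) := by
  unfold rpowExcess
  refine Continuous.div_const (Continuous.sub (Continuous.add ?_ ?_) continuous_const) _
  · exact (continuous_const.add continuous_id).rpow_const fun _ ↦ Or.inr hα.le
  · exact (continuous_const.sub continuous_id).rpow_const fun _ ↦ Or.inr hα.le

lemma rpowExcessDeriv_mul_le {σ α b x y : ℝ} (hα1 : α ≠ 1)
    (hφ : ConvexOn ℝ (Set.Ioi 0) fun x : ℝ ↦ σ * x ^ (α - 2)) (hb0 : 0 ≤ b) (hb1 : b ≤ 1)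
    (hx : 0 < x) (hxy : x < y) (hy : y < 1) :
    σ * rpowExcessDeriv α (b * y) * rpowExcessDeriv α x ≤
      σ * rpowExcessDeriv α (b * x) * rpowExcessDeriv α y := by
  have hbt : ∀ t, 0 ≤ t → t ≤ y → 0 ≤ b * t ∧ b * t < 1 := fun t h0 h1 ↦
    ⟨by positivity, by nlinarith⟩
  have hF : ∀ t, 0 ≤ t → t ≤ y → HasDerivAt (fun t ↦ σ * rpowExcessDeriv α (b * t))
      (σ * (((1 + b * t) ^ (α - 2) + (1 - b * t) ^ (α - 2)) * b)) t := fun t h0 h1 ↦ by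
    have hd := hasDerivAt_rpowExcessDeriv hα1 (hbt t h0 h1).1 (hbt t h0 h1).2
    simpa using (hd.comp t ((hasDerivAt_id t).const_mul b)).const_mul σ
  have hG : ∀ t, 0 ≤ t → t ≤ y → HasDerivAt (rpowExcessDeriv α)
      ((1 + t) ^ (α - 2) + (1 - t) ^ (α - 2)) t := fun t h0 h1 ↦
    hasDerivAt_rpowExcessDeriv hα1 h0 (h1.trans_lt hy)
  refine mul_le_mul_of_deriv_mul_le hx hxy
    (fun t ht ↦ (hF t ht.1 ht.2).continuousAt.continuousWithinAt)
    (fun t ht ↦ (hG t ht.1 ht.2).continuousAt.continuousWithinAt)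
    (fun t ht ↦ hF t ht.1.le ht.2.le) (fun t ht ↦ hG t ht.1.le ht.2.le)
    (by simp [rpowExcessDeriv_zero]) (rpowExcessDeriv_zero α) (fun t ht ↦ ?_)
    fun c d hc hcd hd ↦ ?_
  · have h1 : 0 < 1 - t := by linarith [ht.2]
    have h2 : 0 < 1 + t := by linarith [ht.1]
    positivity
  · have := mul_le_mul_of_nonneg_left
      (rpow_symm_sum_mul_le hφ hb0 hb1 hc hcd (hd.trans hy)) hb0
    linarith

lemma rpowExcess_mul_le_of_lt {σ α b x y : ℝ} (hα : 0 < α) (hα1 : α ≠ 1)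
    (hφ : ConvexOn ℝ (Set.Ioi 0) fun x : ℝ ↦ σ * x ^ (α - 2)) (hb0 : 0 ≤ b) (hb1 : b ≤ 1)
    (hx : 0 < x) (hxy : x < y) (hy : y ≤ 1) :
    σ * rpowExcess α (b * y) * rpowExcess α x ≤ σ * rpowExcess α (b * x) * rpowExcess α y := by
  have hF : ∀ t ∈ Set.Ioo 0 y, HasDerivAt (fun t ↦ σ * rpowExcess α (b * t))
      (σ * (rpowExcessDeriv α (b * t) * b)) t := fun t ht ↦ by
    have hd := hasDerivAt_rpowExcess hα (mul_nonneg hb0 ht.1.le)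
      (by nlinarith [ht.1, ht.2] : b * t < 1)
    simpa using (hd.comp t ((hasDerivAt_id t).const_mul b)).const_mul σ
  refine mul_le_mul_of_deriv_mul_le hx hxy
    (continuous_const.mul ((continuous_rpowExcess hα).comp
      (continuous_const.mul continuous_id))).continuousOn
    (continuous_rpowExcess hα).continuousOn hF
    (fun t ht ↦ hasDerivAt_rpowExcess hα ht.1.le (ht.2.trans_le hy))
    (by simp [rpowExcess_zero]) (rpowExcess_zero α)
    (fun t ht ↦ rpowExcessDeriv_pos hα1 ht.1 (ht.2.trans_le hy)) fun c d hc hcd hd ↦ ?_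
  have := mul_le_mul_of_nonneg_left
    (rpowExcessDeriv_mul_le hα1 hφ hb0 hb1 hc hcd (hd.trans_le hy)) hb0
  linarith

/-- The excess is super- or submultiplicative up to normalization, according to the convexity of
`x ↦ σ x ^ (α - 2)`. -/
lemma rpowExcess_mul_le {σ α a b : ℝ} (hα : 0 < α) (hα1 : α ≠ 1)
    (hφ : ConvexOn ℝ (Set.Ioi 0) fun x : ℝ ↦ σ * x ^ (α - 2)) (ha : |a| ≤ 1) (hb : |b| ≤ 1) :
    σ * (rpowExcess α a * rpowExcess α b) ≤ σ * (rpowExcess α (a * b) * rpowExcess α 1) := by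
  rw [← rpowExcess_abs α a, ← rpowExcess_abs α b, ← rpowExcess_abs α (a * b), abs_mul]
  rcases (abs_nonneg a).eq_or_lt with h | h
  · simp [← h, rpowExcess_zero]
  rcases ha.eq_or_lt with h1 | h1
  · rw [h1, one_mul, mul_comm (rpowExcess α 1)]
  · have := rpowExcess_mul_le_of_lt hα hα1 hφ (abs_nonneg b) hb h h1 le_rfl
    rw [mul_one, mul_comm |b|] at this
    linarith

/-- The power sum `∑ x, p x ^ α` of a distribution on two points with bias `a`. -/
noncomputable def binPowSum (α a : ℝ) : ℝ := ((1 + a) / 2) ^ α + ((1 - a) / 2) ^ α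

lemma binPowSum_sub {α a : ℝ} (hα : 0 < α) (hα1 : α ≠ 1) (ha : |a| ≤ 1) :
    binPowSum α a - 2 ^ (1 - α) = α * (α - 1) / 2 ^ α * rpowExcess α a := by
  obtain ⟨h1, h2⟩ := abs_le.1 ha
  have h3 : α - 1 ≠ 0 := sub_ne_zero.2 hα1
  have h4 : (0 : ℝ) < 2 ^ α := by positivity
  rw [binPowSum, rpowExcess, Real.div_rpow (by linarith) (by norm_num),
    Real.div_rpow (by linarith) (by norm_num), Real.rpow_sub (by norm_num), Real.rpow_one]
  field_simp

lemma binPowSum_one {α : ℝ} (hα : 0 < α) : binPowSum α 1 = 1 := by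
  norm_num [binPowSum, Real.zero_rpow hα.ne']

lemma binPowSum_mul_le {σ α a b : ℝ} (hα : 0 < α) (hα1 : α ≠ 1)
    (hφ : ConvexOn ℝ (Set.Ioi 0) fun x : ℝ ↦ σ * x ^ (α - 2)) (ha : |a| ≤ 1) (hb : |b| ≤ 1) :
    σ * ((binPowSum α a - 2 ^ (1 - α)) * (binPowSum α b - 2 ^ (1 - α))) ≤
      σ * ((binPowSum α (a * b) - 2 ^ (1 - α)) * (1 - 2 ^ (1 - α))) := by
  have hab : |a * b| ≤ 1 := by
    rw [abs_mul]
    exact mul_le_one₀ ha (abs_nonneg b) hb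
  have h1 : (1 : ℝ) - 2 ^ (1 - α) = α * (α - 1) / 2 ^ α * rpowExcess α 1 := by
    rw [← binPowSum_sub hα hα1 (by simp), binPowSum_one hα]
  rw [h1, binPowSum_sub hα hα1 ha, binPowSum_sub hα hα1 hb, binPowSum_sub hα hα1 hab]
  have := mul_le_mul_of_nonneg_left (rpowExcess_mul_le hα hα1 hφ ha hb)
    (sq_nonneg (α * (α - 1) / 2 ^ α))
  linarith

lemma binPowSum_pos {α a : ℝ} (ha : |a| ≤ 1) : 0 < binPowSum α a := by
  obtain ⟨h1, h2⟩ := abs_le.1 ha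
  have e1 : 0 ≤ (1 + a) / 2 := by linarith
  have e2 : 0 ≤ (1 - a) / 2 := by linarith
  rcases le_or_gt a 0 with h | h
  · exact add_pos_of_nonneg_of_pos (Real.rpow_nonneg e1 α) (Real.rpow_pos_of_pos (by linarith) α)
  · exact add_pos_of_pos_of_nonneg (Real.rpow_pos_of_pos (by linarith) α) (Real.rpow_nonneg e2 α)

lemma le_binPowSum {α a : ℝ} (hα : 1 ≤ α) (ha : |a| ≤ 1) : 2 ^ (1 - α) ≤ binPowSum α a := by
  obtain ⟨h1, h2⟩ := abs_le.1 ha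
  have h := (convexOn_rpow hα).add_le_add_of_abs_le (A := 1 / 2) (s := |a| / 2) (t := 0)
    (by rw [Set.mem_Ici]; positivity) (by rw [Set.mem_Ici]; linarith) (by rw [abs_zero]; positivity)
  have hδ : (2 : ℝ) ^ (1 - α) = (1 / 2) ^ α + (1 / 2) ^ α := by
    rw [Real.rpow_sub (by norm_num), Real.rpow_one, Real.div_rpow (by norm_num) (by norm_num),
      Real.one_rpow]
    ring
  rw [add_zero, sub_zero] at h
  rw [hδ]
  refine h.trans (le_of_eq ?_)
  rcases abs_choice a with h | h
  · rw [h, binPowSum, add_div, sub_div]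
  · rw [h, binPowSum, add_div, sub_div, add_comm, neg_div, sub_neg_eq_add, sub_eq_add_neg]

section BinaryInput

/-- The bias of the binary input conditionally on `y`. -/
noncomputable def bias {Y : Type*} (p : ZMod 2 × Y → ℝ) (y : Y) : ℝ :=
  (p (0, y) - p (1, y)) / margY p y

/-- The conditional power sum `∑ y, p y * ∑ x, p(x|y) ^ α`. -/
noncomputable def condPowSum {X Y : Type*} [Fintype X] [Fintype Y] (α : ℝ) (p : X × Y → ℝ) : ℝ :=
  ∑ y, margY p y * ∑ x, condXY p x y ^ α

lemma sum_zmod_two (f : ZMod 2 → ℝ) : ∑ x, f x = f 0 + f 1 := Fin.sum_univ_two f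

lemma margY_nonneg {X Y : Type*} [Fintype X] {p : X × Y → ℝ} (hp : ∀ ω, 0 ≤ p ω) (y : Y) :
    0 ≤ margY p y := Finset.sum_nonneg fun _ _ ↦ hp _

lemma sum_margY {X Y : Type*} [Fintype X] [Fintype Y] {p : X × Y → ℝ} (hp : IsPMF p) :
    ∑ y, margY p y = 1 := by
  rw [← hp.2, Fintype.sum_prod_type_right]
  rfl

variable {Y : Type*} {p : ZMod 2 × Y → ℝ}

lemma abs_bias_le_one (hp : ∀ ω, 0 ≤ p ω) (y : Y) : |bias p y| ≤ 1 := by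
  rw [bias, abs_div, abs_of_nonneg (margY_nonneg hp y)]
  refine div_le_one_of_le₀ ?_ (margY_nonneg hp y)
  rw [margY, sum_zmod_two, abs_le]
  constructor <;> linarith [hp (0, y), hp (1, y)]

lemma condPowSum_eq [Fintype Y] (α : ℝ) (p : ZMod 2 × Y → ℝ) :
    condPowSum α p = ∑ y, margY p y * binPowSum α (bias p y) := by
  refine Finset.sum_congr rfl fun y _ ↦ ?_
  rcases eq_or_ne (margY p y) 0 with h | h
  · rw [h, zero_mul, zero_mul]
  · have hm : margY p y = p (0, y) + p (1, y) := sum_zmod_two _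
    have h0 : condXY p 0 y = (1 + bias p y) / 2 := by
      rw [condXY, bias]; field_simp; rw [hm]; ring
    have h1 : condXY p 1 y = (1 - bias p y) / 2 := by
      rw [condXY, bias]; field_simp; rw [hm]; ring
    rw [sum_zmod_two, h0, h1, binPowSum]

lemma condPowSum_pos [Fintype Y] (α : ℝ) (hp : IsPMF p) : 0 < condPowSum α p := by
  rw [condPowSum_eq]
  have hpos : ∀ y, 0 < binPowSum α (bias p y) := fun y ↦ binPowSum_pos (abs_bias_le_one hp.1 y)
  obtain ⟨y, hy⟩ : ∃ y, 0 < margY p y := by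
    by_contra! h
    linarith [sum_margY hp, Finset.sum_nonpos fun y (_ : y ∈ Finset.univ) ↦ h y]
  exact Finset.sum_pos' (fun y _ ↦ mul_nonneg (margY_nonneg hp.1 y) (hpos y).le)
    ⟨y, Finset.mem_univ y, mul_pos hy (hpos y)⟩

lemma condPowSum_sub [Fintype Y] (α c : ℝ) (hp : IsPMF p) :
    condPowSum α p - c = ∑ y, margY p y * (binPowSum α (bias p y) - c) := by
  simp only [mul_sub, Finset.sum_sub_distrib, ← Finset.sum_mul, sum_margY hp, one_mul,
    condPowSum_eq]

lemma le_condPowSum [Fintype Y] {α : ℝ} (hα : 1 ≤ α) (hp : IsPMF p) :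
    2 ^ (1 - α) ≤ condPowSum α p := by
  rw [← sub_nonneg, condPowSum_sub α _ hp]
  exact Finset.sum_nonneg fun y _ ↦ mul_nonneg (margY_nonneg hp.1 y)
    (sub_nonneg.2 (le_binPowSum hα (abs_bias_le_one hp.1 y)))

lemma HH_eq_log_condPowSum [Fintype Y] (α : ℝ) (p : ZMod 2 × Y → ℝ) :
    HH α p = (1 / (1 - α)) * Real.log (condPowSum α p) := rfl

lemma exp_mul_HH [Fintype Y] {α : ℝ} (hα1 : α ≠ 1) (hp : IsPMF p) :
    Real.exp ((1 - α) * HH α p) = condPowSum α p := by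
  rw [HH_eq_log_condPowSum, ← mul_assoc, mul_one_div_cancel (sub_ne_zero.2 hα1.symm), one_mul,
    Real.exp_log (condPowSum_pos α hp)]

end BinaryInput

section Combining

variable {Z1 Z2 : Type*} {p1 : ZMod 2 × Z1 → ℝ} {p2 : ZMod 2 × Z2 → ℝ}

lemma combinedZ_zero [Fintype Z1] [Fintype Z2] (y : Z1 × Z2) : combinedZ p1 p2 (0, y) =
    p1 (0, y.1) * p2 (0, y.2) + p1 (1, y.1) * p2 (1, y.2) := by
  simp [combinedZ, sum_zmod_two]

lemma combinedZ_one [Fintype Z1] [Fintype Z2] (y : Z1 × Z2) : combinedZ p1 p2 (1, y) =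
    p1 (1, y.1) * p2 (0, y.2) + p1 (0, y.1) * p2 (1, y.2) := by
  simp [combinedZ, sum_zmod_two, show (1 + 1 : ZMod 2) = 0 from rfl]

lemma margY_combinedZ [Fintype Z1] [Fintype Z2] (y : Z1 × Z2) :
    margY (combinedZ p1 p2) y = margY p1 y.1 * margY p2 y.2 := by
  simp only [margY, sum_zmod_two, combinedZ_zero, combinedZ_one]
  ring

lemma bias_combinedZ [Fintype Z1] [Fintype Z2] (y : Z1 × Z2) :
    bias (combinedZ p1 p2) y = bias p1 y.1 * bias p2 y.2 := by
  rw [bias, bias, bias, margY_combinedZ, div_mul_div_comm, combinedZ_zero, combinedZ_one]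
  ring

lemma isPMF_combinedZ [Fintype Z1] [Fintype Z2] (hp1 : IsPMF p1) (hp2 : IsPMF p2) :
    IsPMF (combinedZ p1 p2) := by
  refine ⟨fun ω ↦ Finset.sum_nonneg fun x _ ↦ mul_nonneg (hp1.1 _) (hp2.1 _), ?_⟩
  have h : ∑ ω, combinedZ p1 p2 ω = ∑ y, margY (combinedZ p1 p2) y :=
    Fintype.sum_prod_type_right _
  rw [h]
  simp only [margY_combinedZ]
  rw [Fintype.sum_prod_type, ← Fintype.sum_mul_sum, sum_margY hp1, sum_margY hp2, one_mul]

lemma condPowSum_mul_le [Fintype Z1] [Fintype Z2] (hp1 : IsPMF p1) (hp2 : IsPMF p2) {σ α : ℝ}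
    (hα : 0 < α) (hα1 : α ≠ 1) (hφ : ConvexOn ℝ (Set.Ioi 0) fun x : ℝ ↦ σ * x ^ (α - 2)) :
    σ * ((condPowSum α p1 - 2 ^ (1 - α)) * (condPowSum α p2 - 2 ^ (1 - α))) ≤
      σ * ((condPowSum α (combinedZ p1 p2) - 2 ^ (1 - α)) * (1 - 2 ^ (1 - α))) := by
  rw [condPowSum_sub α _ hp1, condPowSum_sub α _ hp2, condPowSum_sub α _ (isPMF_combinedZ hp1 hp2),
    Fintype.sum_mul_sum, ← Fintype.sum_prod_type', Finset.sum_mul, Finset.mul_sum, Finset.mul_sum]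
  refine Finset.sum_le_sum fun y _ ↦ ?_
  rw [margY_combinedZ, bias_combinedZ]
  have := mul_le_mul_of_nonneg_left (binPowSum_mul_le hα hα1 hφ (abs_bias_le_one hp1.1 y.1)
    (abs_bias_le_one hp2.1 y.2)) (mul_nonneg (margY_nonneg hp1.1 y.1) (margY_nonneg hp2.1 y.2))
  linarith

/-- The check-node bound where `x ↦ x ^ (α - 2)` is convex. -/
lemma HH_combinedZ_le [Fintype Z1] [Fintype Z2] (hp1 : IsPMF p1) (hp2 : IsPMF p2) {α : ℝ}
    (hα : 0 < α) (hα1 : α ≠ 1) (h : α ≤ 2 ∨ 3 ≤ α) :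
    HH α (combinedZ p1 p2) ≤ (1 / (1 - α)) * Real.log
      (((2:ℝ) ^ (1 - α) - Real.exp ((1 - α) * HH α p1)) *
        ((2:ℝ) ^ (1 - α) - Real.exp ((1 - α) * HH α p2)) /
          (1 - (2:ℝ) ^ (1 - α)) + (2:ℝ) ^ (1 - α)) := by
  have hφ : ConvexOn ℝ (Set.Ioi 0) fun x : ℝ ↦ 1 * x ^ (α - 2) := by
    simp only [one_mul]
    rcases h with h | h
    · exact convexOn_rpow_of_nonpos (by linarith)
    · exact (convexOn_rpow (by linarith)).subset Set.Ioi_subset_Ici_self (convex_Ioi 0)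
  have key := condPowSum_mul_le hp1 hp2 hα hα1 hφ
  have hδ : (0 : ℝ) < 2 ^ (1 - α) := by positivity
  rw [exp_mul_HH hα1 hp1, exp_mul_HH hα1 hp2, HH_eq_log_condPowSum, ← neg_sub (condPowSum α p1),
    ← neg_sub (condPowSum α p2), neg_mul_neg]
  rw [one_mul, one_mul] at key
  rcases hα1.lt_or_gt with h1 | h1
  · have hδ1 : (1 : ℝ) < 2 ^ (1 - α) := Real.one_lt_rpow (by norm_num) (by linarith)
    refine mul_le_mul_of_nonneg_left (Real.log_le_log
      (condPowSum_pos α (isPMF_combinedZ hp1 hp2)) ?_) (one_div_nonneg.2 (by linarith))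
    rw [← sub_le_iff_le_add]
    exact (le_div_iff_of_neg (by linarith)).2 key
  · have hδ1 : (2 : ℝ) ^ (1 - α) < 1 :=
      Real.rpow_lt_one_of_one_lt_of_neg (by norm_num) (by linarith)
    refine mul_le_mul_of_nonpos_left (Real.log_le_log ?_ ?_) (one_div_nonpos.2 (by linarith))
    · exact add_pos_of_nonneg_of_pos (div_nonneg (mul_nonneg
        (sub_nonneg.2 (le_condPowSum h1.le hp1))
        (sub_nonneg.2 (le_condPowSum h1.le hp2))) (by linarith)) hδ
    · rw [← le_sub_iff_add_le]
      exact (div_le_iff₀ (by linarith)).2 key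

/-- The reversed check-node bound where `x ↦ x ^ (α - 2)` is concave. -/
lemma le_HH_combinedZ [Fintype Z1] [Fintype Z2] (hp1 : IsPMF p1) (hp2 : IsPMF p2) {α : ℝ}
    (h2 : 2 ≤ α) (h3 : α ≤ 3) :
    (1 / (1 - α)) * Real.log
      (((2:ℝ) ^ (1 - α) - Real.exp ((1 - α) * HH α p1)) *
        ((2:ℝ) ^ (1 - α) - Real.exp ((1 - α) * HH α p2)) /
          (1 - (2:ℝ) ^ (1 - α)) + (2:ℝ) ^ (1 - α)) ≤ HH α (combinedZ p1 p2) := by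
  have hφ : ConvexOn ℝ (Set.Ioi 0) fun x : ℝ ↦ (-1) * x ^ (α - 2) := by
    simp only [neg_one_mul]
    exact ((Real.concaveOn_rpow (by linarith) (by linarith)).subset Set.Ioi_subset_Ici_self
      (convex_Ioi 0)).neg
  have hα1 : α ≠ 1 := by linarith
  have key := condPowSum_mul_le hp1 hp2 (by linarith) hα1 hφ
  have hδ1 : (2 : ℝ) ^ (1 - α) < 1 :=
    Real.rpow_lt_one_of_one_lt_of_neg (by norm_num) (by linarith)
  rw [exp_mul_HH hα1 hp1, exp_mul_HH hα1 hp2, HH_eq_log_condPowSum, ← neg_sub (condPowSum α p1),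
    ← neg_sub (condPowSum α p2), neg_mul_neg]
  refine mul_le_mul_of_nonpos_left (Real.log_le_log
    (condPowSum_pos α (isPMF_combinedZ hp1 hp2)) ?_) (one_div_nonpos.2 (by linarith))
  rw [← sub_le_iff_le_add]
  exact (le_div_iff₀ (by linarith)).2 (by linarith)

end Combining

/-- **Hayashi BEC bound for the check node.** -/
theorem hayashi_bec_bound
    (p1 : ZMod 2 × Y1 → ℝ) (p2 : ZMod 2 × Y2 → ℝ) (hp1 : IsPMF p1) (hp2 : IsPMF p2)
    (α : ℝ) (hα0 : 0 < α) :
    (α ∈ Set.Ioo (0:ℝ) 1 ∪ Set.Ioc (1:ℝ) 2 ∪ Set.Ici (3:ℝ) →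
      HH α (combinedZ p1 p2) ≤ (1 / (1 - α)) * Real.log
        (((2:ℝ) ^ (1 - α) - Real.exp ((1 - α) * HH α p1)) *
          ((2:ℝ) ^ (1 - α) - Real.exp ((1 - α) * HH α p2)) /
            (1 - (2:ℝ) ^ (1 - α)) + (2:ℝ) ^ (1 - α))) ∧
    (α ∈ Set.Icc (2:ℝ) 3 →
      HH α (combinedZ p1 p2) ≥ (1 / (1 - α)) * Real.log
        (((2:ℝ) ^ (1 - α) - Real.exp ((1 - α) * HH α p1)) *
          ((2:ℝ) ^ (1 - α) - Real.exp ((1 - α) * HH α p2)) /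
            (1 - (2:ℝ) ^ (1 - α)) + (2:ℝ) ^ (1 - α))) ∧
    (α = 2 ∨ α = 3 →
      HH α (combinedZ p1 p2) = (1 / (1 - α)) * Real.log
        (((2:ℝ) ^ (1 - α) - Real.exp ((1 - α) * HH α p1)) *
          ((2:ℝ) ^ (1 - α) - Real.exp ((1 - α) * HH α p2)) /
            (1 - (2:ℝ) ^ (1 - α)) + (2:ℝ) ^ (1 - α))) := by
  
  refine ⟨?_, fun h ↦ le_HH_combinedZ hp1 hp2 h.1 h.2, ?_⟩
  · rintro ((h | h) | h)
    · exact HH_combinedZ_le hp1 hp2 hα0 h.2.ne (Or.inl (by linarith [h.2]))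
    · exact HH_combinedZ_le hp1 hp2 hα0 h.1.ne' (Or.inl h.2)
    · rw [Set.mem_Ici] at h
      exact HH_combinedZ_le hp1 hp2 hα0 (by linarith) (Or.inr h)
  · rintro (rfl | rfl)
    · exact le_antisymm (HH_combinedZ_le hp1 hp2 hα0 (by norm_num) (by norm_num))
        (le_HH_combinedZ hp1 hp2 (by norm_num) (by norm_num))
    · exact le_antisymm (HH_combinedZ_le hp1 hp2 hα0 (by norm_num) (by norm_num))
        (le_HH_combinedZ hp1 hp2 (by norm_num) (by norm_num))
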